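/- Let α ∈ ℝ, k ∈ ℤ, and f ∈ T^α(ℝ). Then the function g(x) := f(x) · (x + i)^k belongs to T^{α+k}(ℝ), and for every integer m ≥ 0 there is a constant C (depending only on k and m, not on f) such that ‖g‖_{T^{α+k},m} ≤ C · Σ_{j=0}^{m} ‖f‖_{T^α,j}. -/

import Mathlib

open MeasureTheory Filter Topology
open scoped ENNReal NNReal

noncomputable section

/-- The Japanese bracket `⟨x⟩ = (1 + x²)^(1/2)`. -/
def jb (x : ℝ) : ℝ := Real.sqrt (1 + x ^ 2)

/-- The weight `‖f⁽ᵏ⁾(x)‖ ⟨x⟩^(k−β)` defining the `S^β` seminorms. -/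
def sWeight (β : ℝ) (k : ℕ) (f : ℝ → ℂ) (x : ℝ) : ℝ :=
  ‖iteratedDeriv k f x‖ * jb x ^ ((k : ℝ) - β)

/-- The `S^β` seminorm `‖f‖_{S^β,k} = sup_x ‖f⁽ᵏ⁾(x)‖ ⟨x⟩^(k−β)`. -/
def SNorm (β : ℝ) (k : ℕ) (f : ℝ → ℂ) : ℝ := ⨆ x : ℝ, sWeight β k f x

/-- Membership in `S^β(ℝ)`: smooth with all the seminorms finite. -/
def MemS (β : ℝ) (f : ℝ → ℂ) : Prop :=
  ContDiff ℝ (⊤ : ℕ∞) f ∧ ∀ k : ℕ, BddAbove (Set.range (sWeight β k f))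

/-- The weight `‖f⁽ᵏ⁾(x)‖ ⟨x⟩^(k−β−1)` defining the `T^β` seminorms. -/
def tWeight (β : ℝ) (k : ℕ) (f : ℝ → ℂ) (x : ℝ) : ℝ :=
  ‖iteratedDeriv k f x‖ * jb x ^ ((k : ℝ) - β - 1)

/-- The `T^β` seminorm `‖f‖_{T^β,k} = ∫ ‖f⁽ᵏ⁾(x)‖ ⟨x⟩^(k−β−1) dx`. -/
def TNorm (β : ℝ) (k : ℕ) (f : ℝ → ℂ) : ℝ := ∫ x : ℝ, tWeight β k f x

/-- Membership in `T^β(ℝ)`: smooth with all the seminorms finite. -/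
def MemT (β : ℝ) (f : ℝ → ℂ) : Prop :=
  ContDiff ℝ (⊤ : ℕ∞) f ∧ ∀ k : ℕ, Integrable (tWeight β k f)

/-- `F` is the sequence of divided differences of `f`: `F 0 = f`, each `F m` is
continuous, and the divided-difference recursion holds off the diagonal. -/
def IsDivDiff (f : ℝ → ℂ) (F : (m : ℕ) → (Fin (m + 1) → ℝ) → ℂ) : Prop :=
  (∀ x : Fin 1 → ℝ, F 0 x = f (x 0)) ∧
  (∀ m, Continuous (F m)) ∧
  (∀ m, ∀ x : Fin (m + 2) → ℝ, x 0 ≠ x (Fin.last (m + 1)) →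
    F (m + 1) x = (F m (fun i => x i.succ) - F m (fun i => x i.castSucc)) /
      ((x 0 - x (Fin.last (m + 1)) : ℝ) : ℂ))

end

noncomputable section

/-- The factor `|∏_{i<n} (k - i)|` produced by differentiating a `k`-th power `n` times. -/
def fallingAbs (k : ℤ) (n : ℕ) : ℝ := ‖∏ i ∈ Finset.range n, ((k : ℂ) - i)‖

end

theorem jb_pos (x : ℝ) : 0 < jb x := Real.sqrt_pos.2 (by positivity)

theorem continuous_jb : Continuous jb := by
  unfold jb
  fun_prop

theorem norm_ofReal_add_I (x : ℝ) : ‖(x : ℂ) + Complex.I‖ = jb x := by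
  have h := Complex.norm_add_mul_I x 1
  rw [Complex.ofReal_one, one_mul] at h
  rw [h, jb]
  congr 1
  ring

theorem ofReal_add_I_ne_zero (x : ℝ) : (x : ℂ) + Complex.I ≠ 0 :=
  norm_pos_iff.1 (norm_ofReal_add_I x ▸ jb_pos x)

theorem hasDerivAt_ofReal_add_I_zpow (k : ℤ) (x : ℝ) :
    HasDerivAt (fun y : ℝ => ((y : ℂ) + Complex.I) ^ k)
      (k * ((x : ℂ) + Complex.I) ^ (k - 1)) x := by
  have h := (hasDerivAt_zpow k _ (Or.inl (ofReal_add_I_ne_zero x))).comp x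
    ((Complex.ofRealCLM.hasDerivAt (x := x)).add_const Complex.I)
  simpa [Function.comp_def] using h

theorem iteratedDeriv_ofReal_add_I_zpow (k : ℤ) (n : ℕ) :
    iteratedDeriv n (fun y : ℝ => ((y : ℂ) + Complex.I) ^ k) =
      fun y : ℝ => (∏ i ∈ Finset.range n, ((k : ℂ) - i)) * ((y : ℂ) + Complex.I) ^ (k - n) := by
  induction n with
  | zero => simp
  | succ n ih =>
    ext x
    rw [iteratedDeriv_succ, ih,
      ((hasDerivAt_ofReal_add_I_zpow (k - n) x).const_mul _).deriv, Finset.prod_range_succ]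
    push_cast
    rw [sub_sub]
    ring

theorem contDiff_ofReal_add_I_zpow (k : ℤ) (n : ℕ∞) :
    ContDiff ℝ n (fun y : ℝ => ((y : ℂ) + Complex.I) ^ k) := by
  refine contDiff_of_differentiable_iteratedDeriv fun m _ => ?_
  rw [iteratedDeriv_ofReal_add_I_zpow]
  exact fun x => ((hasDerivAt_ofReal_add_I_zpow (k - m) x).const_mul _).differentiableAt

theorem norm_iteratedDeriv_ofReal_add_I_zpow (k : ℤ) (n : ℕ) (x : ℝ) :
    ‖iteratedDeriv n (fun y : ℝ => ((y : ℂ) + Complex.I) ^ k) x‖ =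
      fallingAbs k n * jb x ^ ((k : ℝ) - n) := by
  rw [iteratedDeriv_ofReal_add_I_zpow, norm_mul, norm_zpow, norm_ofReal_add_I, fallingAbs,
    ← Real.rpow_intCast]
  push_cast
  rfl

theorem tWeight_nonneg (β : ℝ) (n : ℕ) (f : ℝ → ℂ) (x : ℝ) : 0 ≤ tWeight β n f x :=
  mul_nonneg (norm_nonneg _) (Real.rpow_nonneg (jb_pos x).le _)

theorem continuous_tWeight (β : ℝ) (n : ℕ) {f : ℝ → ℂ} (hf : ContDiff ℝ (⊤ : ℕ∞) f) :
    Continuous (tWeight β n f) :=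
  (hf.continuous_iteratedDeriv n (mod_cast le_top)).norm.mul
    (continuous_jb.rpow_const fun x => Or.inl (jb_pos x).ne')

/-- Leibniz bound for the `T`-weights of `f(x)·(x + i)^k`. -/
theorem tWeight_mul_zpow_le (α : ℝ) (k : ℤ) (m : ℕ) {f : ℝ → ℂ}
    (hf : ContDiff ℝ (⊤ : ℕ∞) f) (x : ℝ) :
    tWeight (α + k) m (fun x : ℝ => f x * ((x : ℂ) + Complex.I) ^ k) x ≤
      ∑ j ∈ Finset.range (m + 1), (m.choose j * fallingAbs k (m - j)) * tWeight α j f x := by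
  have h := norm_iteratedFDeriv_mul_le hf (contDiff_ofReal_add_I_zpow k ⊤) x (n := m)
    (mod_cast le_top)
  simp only [norm_iteratedFDeriv_eq_norm_iteratedDeriv,
    norm_iteratedDeriv_ofReal_add_I_zpow] at h
  refine (mul_le_mul_of_nonneg_right h (Real.rpow_nonneg (jb_pos x).le _)).trans_eq ?_
  rw [Finset.sum_mul]
  refine Finset.sum_congr rfl fun j hj => ?_
  have hexp : (j : ℝ) - α - 1 =
      ((k : ℝ) - ((m - j : ℕ) : ℝ)) + ((m : ℝ) - (α + k) - 1) := by
    rw [Nat.cast_sub (Finset.mem_range_succ_iff.1 hj)]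
    ring
  rw [tWeight, hexp, Real.rpow_add (jb_pos x)]
  ring

theorem MemT.mul_zpow {α : ℝ} {f : ℝ → ℂ} (hf : MemT α f) (k : ℤ) :
    MemT (α + k) (fun x : ℝ => f x * ((x : ℂ) + Complex.I) ^ k) := by
  have hg := hf.1.mul (contDiff_ofReal_add_I_zpow k ⊤)
  refine ⟨hg, fun n => ?_⟩
  refine Integrable.mono'
    (integrable_finsetSum (Finset.range (n + 1)) fun j _ =>
      (hf.2 j).const_mul (n.choose j * fallingAbs k (n - j)))
    (continuous_tWeight _ n hg).aestronglyMeasurable (ae_of_all _ fun x => ?_)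
  rw [Real.norm_of_nonneg (tWeight_nonneg _ _ _ _)]
  exact tWeight_mul_zpow_le α k n hf.1 x

/-- Let `k ∈ ℤ` and `m ≥ 0`. There is a constant `C` (depending only
on `k` and `m`) such that for every `α ∈ ℝ` and every `f ∈ T^α(ℝ)`, the function
`g(x) = f(x)·(x + i)^k` belongs to `T^{α+k}(ℝ)` and
`‖g‖_{T^{α+k},m} ≤ C · Σ_{j=0}^m ‖f‖_{T^α,j}`. -/
theorem stmt19 (k : ℤ) (m : ℕ) :
    ∃ C : ℝ, 0 ≤ C ∧
      ∀ (α : ℝ) (f : ℝ → ℂ), MemT α f →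
        MemT (α + (k : ℝ)) (fun x : ℝ => f x * ((x : ℂ) + Complex.I) ^ k) ∧
        TNorm (α + (k : ℝ)) m (fun x : ℝ => f x * ((x : ℂ) + Complex.I) ^ k) ≤
          C * ∑ j ∈ Finset.range (m + 1), TNorm α j f := by
  have hc (j : ℕ) : 0 ≤ m.choose j * fallingAbs k (m - j) :=
    mul_nonneg (Nat.cast_nonneg _) (norm_nonneg _)
  refine ⟨∑ j ∈ Finset.range (m + 1), m.choose j * fallingAbs k (m - j),
    Finset.sum_nonneg fun j _ => hc j, fun α f hf => ⟨hf.mul_zpow k, ?_⟩⟩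
  have hint (j : ℕ) :
      Integrable fun x => (m.choose j * fallingAbs k (m - j)) * tWeight α j f x :=
    (hf.2 j).const_mul _
  calc TNorm (α + k) m (fun x : ℝ => f x * ((x : ℂ) + Complex.I) ^ k)
      ≤ ∫ x, ∑ j ∈ Finset.range (m + 1),
          (m.choose j * fallingAbs k (m - j)) * tWeight α j f x :=
        integral_mono ((hf.mul_zpow k).2 m) (integrable_finsetSum _ fun j _ => hint j)
          (tWeight_mul_zpow_le α k m hf.1)
    _ = ∑ j ∈ Finset.range (m + 1), (m.choose j * fallingAbs k (m - j)) * TNorm α j f := by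
        rw [integral_finsetSum _ fun j _ => hint j]
        exact Finset.sum_congr rfl fun j _ => integral_const_mul _ _
    _ ≤ _ := by
        rw [Finset.sum_mul]
        refine Finset.sum_le_sum fun j hj => mul_le_mul_of_nonneg_left ?_ (hc j)
        exact Finset.single_le_sum (f := fun j => TNorm α j f)
          (fun i _ => integral_nonneg (tWeight_nonneg α i f)) hj
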